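/- Assume the sequence R_1, …, R_m is disjoint-superset and d_i ≥ 1 for every i. Then for every i with 1 ≤ i ≤ m, every j ≤ i, and all coins c, c' ∈ R_j: if Pr_j(c) ≤ Pr_j(c'), then Pr_i(c) ≤ Pr_i(c'). -/

import Mathlib

open scoped Classical

/-- The spent coin permutations for the first `k` ring signatures of the
sequence `R` (rings are indexed from `1`): injective functions `σ : Fin k → C`
with `σ(j) ∈ R_j` for each `j ∈ {1, …, k}` (position `j` of `σ` is `j - 1`). -/
noncomputable def perms {C : Type*} [Fintype C] [DecidableEq C]
    (R : ℕ → Finset C) (k : ℕ) : Finset (Fin k → C) :=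
  Finset.univ.filter fun σ => Function.Injective σ ∧ ∀ j : Fin k, σ j ∈ R (j.1 + 1)

/-- `N_k`, the number of spent coin permutations for the first `k` ring signatures. -/
noncomputable def numPerms {C : Type*} [Fintype C] [DecidableEq C]
    (R : ℕ → Finset C) (k : ℕ) : ℕ :=
  (perms R k).card

/-- `Pr_k(c, r_j)`: the fraction of spent coin permutations `σ` for the first `k`
ring signatures with `σ(j) = c`. -/
noncomputable def prSpentIn {C : Type*} [Fintype C] [DecidableEq C]
    (R : ℕ → Finset C) (k j : ℕ) (c : C) : ℝ :=
  (((perms R k).filter fun σ => ∃ h : j - 1 < k, σ ⟨j - 1, h⟩ = c).card : ℝ) /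
    (numPerms R k : ℝ)

/-- `Pr_k(c)`: the fraction of spent coin permutations `σ` for the first `k`
ring signatures having `c` in their image. -/
noncomputable def prSpent {C : Type*} [Fintype C] [DecidableEq C]
    (R : ℕ → Finset C) (k : ℕ) (c : C) : ℝ :=
  (((perms R k).filter fun σ => ∃ j, σ j = c).card : ℝ) / (numPerms R k : ℝ)

/-- `Pr_k(r_j | c) = Pr_k(c, r_j) / Pr_k(c)`. -/
noncomputable def prCond {C : Type*} [Fintype C] [DecidableEq C]
    (R : ℕ → Finset C) (k j : ℕ) (c : C) : ℝ :=
  prSpentIn R k j c / prSpent R k c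

/-- The first `m` ring signatures of `R` are disjoint-superset: for all
`1 ≤ j < i ≤ m`, either `R_i ∩ R_j = ∅` or `R_j ⊆ R_i`. -/
def DisjointSuperset {C : Type*} [Fintype C] [DecidableEq C]
    (R : ℕ → Finset C) (m : ℕ) : Prop :=
  ∀ i j, 1 ≤ j → j < i → i ≤ m → Disjoint (R i) (R j) ∨ R j ⊆ R i

/-- `ns_i`: the number of indices `j < i` with `R_j ⊆ R_i`. -/
noncomputable def nsub {C : Type*} [Fintype C] [DecidableEq C]
    (R : ℕ → Finset C) (i : ℕ) : ℕ :=
  ((Finset.Ico 1 i).filter fun j => R j ⊆ R i).card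

/-- The degree `d_i = |R_i| - ns_i`. -/
noncomputable def deg {C : Type*} [Fintype C] [DecidableEq C]
    (R : ℕ → Finset C) (i : ℕ) : ℕ :=
  (R i).card - nsub R i

/-- Permutations for `k + 1` ring signatures are counted by extending those for `k`. -/
theorem card_filter_perms_succ {C : Type*} [Fintype C] [DecidableEq C]
    (R : ℕ → Finset C) (k : ℕ) (P : (Fin (k + 1) → C) → Prop) [DecidablePred P] :
    ((perms R (k + 1)).filter P).card =
      ∑ σ ∈ perms R k, ((R (k + 1) \ Finset.univ.image σ).filter
        fun x => P (Fin.snoc (α := fun _ => C) σ x)).card := by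
  rw [← Finset.card_sigma]
  refine Finset.card_bij' (fun τ _ => ⟨Fin.init τ, τ (Fin.last k)⟩)
    (fun p _ => Fin.snoc (α := fun _ => C) p.1 p.2) ?_ ?_ ?_ ?_
  · intro τ hτ
    simp only [perms, Finset.mem_filter, Finset.mem_univ, true_and] at hτ
    obtain ⟨⟨hinj, hmem⟩, hP⟩ := hτ
    simp only [perms, Finset.mem_sigma, Finset.mem_filter, Finset.mem_univ, true_and,
      Finset.mem_sdiff, Finset.mem_image, not_exists, Fin.snoc_init_self]
    refine ⟨⟨fun a b hab => Fin.castSucc_injective k (hinj hab), fun j => ?_⟩, ⟨?_, ?_⟩, hP⟩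
    · simpa [Fin.init] using hmem j.castSucc
    · simpa using hmem (Fin.last k)
    · intro a ha
      exact (Fin.castSucc_lt_last a).ne (hinj ha)
  · rintro ⟨σ, x⟩ hp
    simp only [perms, Finset.mem_sigma, Finset.mem_filter, Finset.mem_univ, true_and,
      Finset.mem_sdiff, Finset.mem_image, not_exists] at hp
    obtain ⟨⟨hinj, hmem⟩, ⟨hx, hnew⟩, hP⟩ := hp
    simp only [perms, Finset.mem_filter, Finset.mem_univ, true_and]
    refine ⟨⟨?_, fun j => ?_⟩, hP⟩
    · exact Fin.snoc_injective_iff.2 ⟨hinj, by simpa using hnew⟩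
    · induction j using Fin.lastCases with
      | last => simpa using hx
      | cast j => simpa using hmem j
  · intro τ _
    simp
  · rintro ⟨σ, x⟩ _
    simp

/-- Every permutation for `k` ring signatures leaves exactly `d_{k+1}` choices for the next one. -/
theorem card_sdiff_image_eq_deg {C : Type*} [Fintype C] [DecidableEq C]
    {R : ℕ → Finset C} {m k : ℕ} (hds : DisjointSuperset R m) (hk : k + 1 ≤ m)
    {σ : Fin k → C} (hσ : σ ∈ perms R k) :
    (R (k + 1) \ Finset.univ.image σ).card = deg R (k + 1) := by
  simp only [perms, Finset.mem_filter, Finset.mem_univ, true_and] at hσ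
  obtain ⟨hinj, hmem⟩ := hσ
  rw [Finset.card_sdiff, deg, nsub]
  congr 1
  symm
  refine Finset.card_bij
    (fun j hj => σ ⟨j - 1, by simp only [Finset.mem_filter, Finset.mem_Ico] at hj; omega⟩)
    ?_ ?_ ?_
  · intro j hj
    simp only [Finset.mem_filter, Finset.mem_Ico] at hj
    have h := hmem ⟨j - 1, by omega⟩
    simp only [Nat.sub_add_cancel hj.1.1] at h
    exact Finset.mem_inter.2 ⟨Finset.mem_image_of_mem _ (Finset.mem_univ _), hj.2 h⟩
  · intro a ha b hb hab
    simp only [Finset.mem_filter, Finset.mem_Ico] at ha hb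
    have := Fin.mk.inj_iff.1 (hinj hab)
    omega
  · intro x hx
    obtain ⟨hx, hxR⟩ := Finset.mem_inter.1 hx
    obtain ⟨j, -, rfl⟩ := Finset.mem_image.1 hx
    refine ⟨j + 1, ?_, rfl⟩
    simp only [Finset.mem_filter, Finset.mem_Ico]
    refine ⟨⟨by omega, by omega⟩, ?_⟩
    rcases hds (k + 1) (j + 1) (by omega) (by omega) hk with h | h
    · exact absurd (hmem j) (Finset.disjoint_left.1 h hxR)
    · exact h

theorem numPerms_succ {C : Type*} [Fintype C] [DecidableEq C]
    {R : ℕ → Finset C} {m k : ℕ} (hds : DisjointSuperset R m) (hk : k + 1 ≤ m) :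
    numPerms R (k + 1) = numPerms R k * deg R (k + 1) := by
  have h := card_filter_perms_succ R k fun _ => True
  simp only [Finset.filter_true] at h
  rw [numPerms, h, Finset.sum_congr rfl fun σ hσ => card_sdiff_image_eq_deg hds hk hσ]
  simp [numPerms]

theorem numPerms_pos {C : Type*} [Fintype C] [DecidableEq C]
    {R : ℕ → Finset C} {m : ℕ} (hds : DisjointSuperset R m)
    (hdeg : ∀ i, 1 ≤ i → i ≤ m → 1 ≤ deg R i) {k : ℕ} (hk : k ≤ m) : 0 < numPerms R k := by
  induction k with
  | zero =>
    exact Finset.card_pos.2 ⟨default, by simp [perms, Function.injective_of_subsingleton]⟩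
  | succ k ih =>
    rw [numPerms_succ hds hk]
    exact Nat.mul_pos (ih (by omega)) (hdeg _ (by omega) hk)

/-- The number of permutations spending `c` after one more ring signature. -/
theorem card_spent_succ {C : Type*} [Fintype C] [DecidableEq C]
    {R : ℕ → Finset C} {m k : ℕ} (hds : DisjointSuperset R m) (hk : k + 1 ≤ m) (c : C) :
    ((perms R (k + 1)).filter fun σ => ∃ j, σ j = c).card =
      ((perms R k).filter fun σ => ∃ j, σ j = c).card * deg R (k + 1) +
        if c ∈ R (k + 1) then
          numPerms R k - ((perms R k).filter fun σ => ∃ j, σ j = c).card else 0 := by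
  have hterm : ∀ σ ∈ perms R k,
      ((R (k + 1) \ Finset.univ.image σ).filter
        fun x => ∃ j, Fin.snoc (α := fun _ => C) σ x j = c).card =
      if ∃ j, σ j = c then deg R (k + 1) else if c ∈ R (k + 1) then 1 else 0 := by
    intro σ hσ
    have hiff : ∀ x, (∃ j, Fin.snoc (α := fun _ => C) σ x j = c) ↔ (∃ j, σ j = c) ∨ x = c := by
      intro x
      simp [Fin.exists_fin_succ']
    simp only [hiff]
    by_cases h : ∃ j, σ j = c
    · simp only [h, true_or, Finset.filter_true, if_true, card_sdiff_image_eq_deg hds hk hσ]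
    · simp only [h, false_or, if_false, Finset.filter_eq']
      simp only [Finset.mem_sdiff, Finset.mem_image, Finset.mem_univ, true_and, h,
        not_false_eq_true, and_true]
      split_ifs <;> simp
  rw [card_filter_perms_succ, Finset.sum_congr rfl hterm, Finset.sum_ite]
  have hcard := Finset.card_filter_add_card_filter_not (s := perms R k)
    (fun σ => ∃ j, σ j = c)
  simp only [Finset.sum_const, smul_eq_mul]
  congr 1
  split_ifs
  · rw [numPerms, mul_one]
    omega
  · simp

theorem card_spent_succ_le {C : Type*} [Fintype C] [DecidableEq C]
    {R : ℕ → Finset C} {m k : ℕ} (hds : DisjointSuperset R m) (hk : k + 1 ≤ m)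
    (hd : 1 ≤ deg R (k + 1)) {c c' : C} (hcc : c ∈ R (k + 1) ↔ c' ∈ R (k + 1))
    (h : ((perms R k).filter fun σ => ∃ j, σ j = c).card ≤
      ((perms R k).filter fun σ => ∃ j, σ j = c').card) :
    ((perms R (k + 1)).filter fun σ => ∃ j, σ j = c).card ≤
      ((perms R (k + 1)).filter fun σ => ∃ j, σ j = c').card := by
  rw [card_spent_succ hds hk c, card_spent_succ hds hk c']
  have hle : ((perms R k).filter fun σ => ∃ j, σ j = c').card ≤ numPerms R k :=
    Finset.card_filter_le _ _
  obtain ⟨d, hd⟩ := Nat.exists_eq_add_of_le hd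
  have := Nat.mul_le_mul_right d h
  simp only [hcc, hd, mul_add, mul_one]
  split_ifs <;> omega

theorem prSpent_le_prSpent_iff {C : Type*} [Fintype C] [DecidableEq C]
    {R : ℕ → Finset C} {k : ℕ} (hN : 0 < numPerms R k) (c c' : C) :
    prSpent R k c ≤ prSpent R k c' ↔
      ((perms R k).filter fun σ => ∃ j, σ j = c).card ≤
        ((perms R k).filter fun σ => ∃ j, σ j = c').card := by
  rw [prSpent, prSpent, div_le_div_iff_of_pos_right (by exact_mod_cast hN), Nat.cast_le]

theorem stmt4 {C : Type*} [Fintype C] [DecidableEq C]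
    (R : ℕ → Finset C) (m : ℕ)
    (hne : ∀ i, 1 ≤ i → i ≤ m → (R i).Nonempty)
    (hds : DisjointSuperset R m)
    (hdeg : ∀ i, 1 ≤ i → i ≤ m → 1 ≤ deg R i) :
    ∀ i, 1 ≤ i → i ≤ m → ∀ j, 1 ≤ j → j ≤ i → ∀ c ∈ R j, ∀ c' ∈ R j,
      prSpent R j c ≤ prSpent R j c' → prSpent R i c ≤ prSpent R i c' := by
  intro i _ him j hj hji c hc c' hc' h
  rw [prSpent_le_prSpent_iff (numPerms_pos hds hdeg him)]
  rw [prSpent_le_prSpent_iff (numPerms_pos hds hdeg (hji.trans him))] at h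
  induction i, hji using Nat.le_induction with
  | base => exact h
  | succ k hjk ih =>
    refine card_spent_succ_le hds him (hdeg _ (by omega) him) ?_ (ih (by omega) (by omega))
    rcases hds (k + 1) j hj (by omega) him with hdis | hsub
    · exact iff_of_false (Finset.disjoint_right.1 hdis hc) (Finset.disjoint_right.1 hdis hc')
    · exact iff_of_true (hsub hc) (hsub hc')
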